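/- Let q be a prime power, K algebraically closed of characteristic p dividing q, a ∈ K \ {0,1}. Define g(x,u) = ((x-1)(xu-a) - u^q(xu-1)(x-a))/(1-u) ∈ K[x,u] (the quotient is a polynomial). Then the curve g(x,u) = 0 meets the line x = 0 only at the point (0,1), i.e. g(0,u) has u = 1 as its only root. Moreover (0,1) is a nonsingular point of the curve g = 0. -/

import Mathlib

open MvPolynomial

/-- over `K` algebraically closed of characteristic `p` dividing `q`,
`a ∉ {0,1}`: `g(x,u) = ((x-1)(xu-a) - u^q (xu-1)(x-a))/(1-u)` is a polynomial; the
curve `g = 0` meets the line `x = 0` only at `(0,1)`, and `(0,1)` is a nonsingular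
point of `g = 0`. -/
theorem blowup_exceptional_point
    (p n : ℕ) (hp : p.Prime) (hn : n ≠ 0) (q : ℕ) (hq : q = p ^ n)
    (K : Type*) [Field K] [IsAlgClosed K] [CharP K p]
    (a : K) (ha0 : a ≠ 0) (ha1 : a ≠ 1)
    (N : MvPolynomial (Fin 2) K)
    (hN : N = (X 0 - 1) * (X 0 * X 1 - C a) - X 1 ^ q * (X 0 * X 1 - 1) * (X 0 - C a)) :
    (∃ g : MvPolynomial (Fin 2) K, N = (1 - X 1) * g) ∧
    ∀ g : MvPolynomial (Fin 2) K, N = (1 - X 1) * g →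
      (∀ t : K, eval ![0, t] g = 0 ↔ t = 1) ∧ eval ![0, 1] g = 0 ∧
      ¬ (eval ![0, 1] (pderiv 0 g) = 0 ∧ eval ![0, 1] (pderiv 1 g) = 0) := by
  have hq2 : 2 ≤ q := by
    rw [hq]
    exact hp.two_le.trans (Nat.le_self_pow hn p)
  obtain ⟨m, rfl⟩ : ∃ m, q = m + 2 := ⟨q - 2, by omega⟩
  have : Fact p.Prime := ⟨hp⟩
  have hfrob : (1 - X 1 : MvPolynomial (Fin 2) K) ^ (m + 2) = 1 - X 1 ^ (m + 2) := by
    rw [hq, sub_pow_char_pow, one_pow]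
  have hne : (1 - X 1 : MvPolynomial (Fin 2) K) ≠ 0 := by
    intro h
    have := congrArg (eval (fun _ => (0 : K))) h
    simp at this
  have key : N = (1 - X 1) * ((1 - C a) * X 0
      + (1 - X 1) ^ (m + 1) * ((X 0 * X 1 - 1) * (X 0 - C a))) := by
    rw [hN]
    linear_combination (-(X 0 * X 1 - 1) * (X 0 - C a)) * hfrob
  refine ⟨⟨_, key⟩, ?_⟩
  intro g hg
  have hgeq := mul_left_cancel₀ hne (hg.symm.trans key)
  subst hgeq
  refine ⟨?_, ?_, ?_⟩
  · intro t
    simp [ha0, sub_eq_zero]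
    exact eq_comm
  · simp
  · rintro ⟨h, -⟩
    apply ha1
    simp [Derivation.leibniz, Derivation.leibniz_pow, pderiv_X] at h
    first
      | exact (sub_eq_zero.mp h).symm
      | exact h.symm
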